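/- Let n ≥ 1 be a natural number and let λ₁, …, λₙ be positive real numbers with product p = λ₁⋯λₙ. Then for all indices 1 ≤ i, k ≤ n one has |(λᵢλₖ/p)^{1/4} − (λᵢλₖ/p)^{-1/4}| ≤ max_{1 ≤ j ≤ n} |λⱼ^{n/4} − λⱼ^{-n/4}|. -/

import Mathlib

/-- For `t > 0`, `t ^ a - t ^ (-a)` is `2 sinh (a log t)`. -/
theorem abs_rpow_sub_rpow_neg {t : ℝ} (ht : 0 < t) (a : ℝ) :
    |t ^ a - t ^ (-a)| = 2 * Real.sinh |a * Real.log t| := by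
  have h : t ^ a - t ^ (-a) = 2 * Real.sinh (a * Real.log t) := by
    rw [Real.rpow_def_of_pos ht, Real.rpow_def_of_pos ht, Real.sinh_eq]
    ring_nf
  rw [h, abs_mul, abs_two, Real.abs_sinh]

theorem abs_add_sub_sum_le {ι : Type*} [Fintype ι] (x : ι → ℝ) {M : ℝ}
    (hM : ∀ j, |x j| ≤ M) (i k : ι) :
    |x i + x k - ∑ j, x j| ≤ Fintype.card ι * M := by
  classical
  have h : x i + x k - ∑ j, x j =
      ∑ j, ((if j = i then x j else 0) + (if j = k then x j else 0) - x j) := by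
    simp [Finset.sum_sub_distrib, Finset.sum_add_distrib]
  rw [h]
  calc _ ≤ ∑ j, |(if j = i then x j else 0) + (if j = k then x j else 0) - x j| :=
        Finset.abs_sum_le_sum_abs _ _
    _ ≤ ∑ _j : ι, M := by
        refine Finset.sum_le_sum fun j _ => ?_
        have hj := hM j
        have h0 := (abs_nonneg _).trans hj
        split_ifs <;> simpa using by assumption
    _ = Fintype.card ι * M := by simp

/-- For positive reals `λ₁, …, λₙ` (`n ≥ 1`) with product `p`, for all indices
`i, k` one has `|(λᵢλₖ/p)^(1/4) − (λᵢλₖ/p)^(-1/4)| ≤ max_j |λⱼ^(n/4) − λⱼ^(-n/4)|`. -/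
theorem stmt3 (n : ℕ) (hn : 1 ≤ n) (lam : Fin n → ℝ) (hlam : ∀ i, 0 < lam i) (i k : Fin n) :
    |(lam i * lam k / ∏ j, lam j) ^ ((1 : ℝ)/4) -
        (lam i * lam k / ∏ j, lam j) ^ (-(1 : ℝ)/4)| ≤
      Finset.univ.sup' (Finset.univ_nonempty_iff.mpr ⟨⟨0, hn⟩⟩)
        (fun j => |lam j ^ ((n : ℝ)/4) - lam j ^ (-(n : ℝ)/4)|) := by
  have : Nonempty (Fin n) := ⟨i⟩
  obtain ⟨m, hm⟩ := Finite.exists_max fun j => |Real.log (lam j)|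
  refine le_trans ?_ (Finset.le_sup' _ (Finset.mem_univ m))
  have hp : 0 < ∏ j, lam j := Finset.prod_pos fun j _ => hlam j
  have hik : 0 < lam i * lam k := mul_pos (hlam i) (hlam k)
  rw [neg_div, neg_div, abs_rpow_sub_rpow_neg (div_pos hik hp), abs_rpow_sub_rpow_neg (hlam m)]
  refine mul_le_mul_of_nonneg_left (Real.sinh_le_sinh.mpr ?_) zero_le_two
  have key := abs_add_sub_sum_le (fun j => Real.log (lam j)) hm i k
  rw [Fintype.card_fin] at key
  rw [Real.log_div hik.ne' hp.ne', Real.log_mul (hlam i).ne' (hlam k).ne',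
    Real.log_prod fun j _ => (hlam j).ne', abs_mul, abs_mul,
    abs_of_nonneg (by positivity : (0 : ℝ) ≤ 1 / 4),
    abs_of_nonneg (by positivity : (0 : ℝ) ≤ (n : ℝ) / 4)]
  linarith
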